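/- arXiv:1410.5282 — 2 statements merged into one kernel-verified Lean document; each statement's English description precedes it below -/
import Mathlib

section
/- Let n ≥ 1, K ≥ 1, and N' = n^{K−1}. For k = 0, …, n−1 let w_n(k) be the n×1 column matrix with a single 1 in position k and zeros elsewhere, and define the n^K × n^K matrix Q = Σ_{k=0}^{n−1} w_n(k) ⊗ I_{N'} ⊗ w_n(k)ᵀ, where ⊗ is the Kronecker product and I_{N'} is the N'×N' identity matrix. Then Q is a permutation (orthogonal) matrix, Q·Qᵀ = I_{n^K}, and Q^K = I_{n^K}; that is, Q is a valid symmetry operator of order K for the K-ary PPM constellation. -/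
open Matrix Kronecker

theorem ppm_pow_aux {M : ℕ} (σ : Equiv.Perm (Fin M)) (K : ℕ) :
    (σ.permMatrix ℝ) ^ K = (σ ^ K).permMatrix ℝ := by
  induction K with
  | zero => simp
  | succ m ih => rw [pow_succ, ih, pow_succ', Matrix.permMatrix_mul]

theorem ppm_order_aux {n K : ℕ} (hn : 1 ≤ n) (σ : Equiv.Perm (Fin (n ^ K)))
    (h0 : ∀ i : Fin (n ^ K), i.val = 0 → (σ i).val = 0)
    (h : ∀ i : Fin (n ^ K), (σ i).val ≡ n * i.val [MOD (n ^ K - 1)]) : σ ^ K = 1 := by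
  have hM : 1 ≤ n ^ K := Nat.one_le_pow _ _ hn
  have h1 : ∀ (m : ℕ) (i : Fin (n ^ K)),
      ((σ ^ m) i).val ≡ n ^ m * i.val [MOD (n ^ K - 1)] := by
    intro m
    induction m with
    | zero => intro i; simp; rfl
    | succ m ih =>
      intro i
      rw [pow_succ', Equiv.Perm.mul_apply]
      refine (h _).trans ?_
      rw [pow_succ', mul_assoc]
      exact (ih i).mul_left n
  have h2 : ∀ (m : ℕ) (i : Fin (n ^ K)), i.val = 0 → ((σ ^ m) i).val = 0 := by
    intro m
    induction m with
    | zero => intro i hi; simpa using hi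
    | succ m ih =>
      intro i hi
      rw [pow_succ', Equiv.Perm.mul_apply]
      exact h0 _ (ih i hi)
  have h3 : n ^ K ≡ 1 [MOD (n ^ K - 1)] :=
    ((Nat.modEq_iff_dvd' hM).2 dvd_rfl).symm
  ext i
  rw [Equiv.Perm.one_apply]
  have h4 : ((σ ^ K) i).val ≡ i.val [MOD (n ^ K - 1)] := by
    simpa using (h1 K i).trans (h3.mul_right i.val)
  have hz := h2 K ⟨0, hM⟩ rfl
  by_cases hi : i.val = 0
  · rw [h2 K i hi, hi]
  by_cases hs : ((σ ^ K) i).val = 0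
  · exfalso
    have : (σ ^ K) i = (σ ^ K) ⟨0, hM⟩ := Fin.ext (by rw [hs, hz])
    exact hi (congrArg Fin.val ((σ ^ K).injective this))
  have hi2 := i.isLt
  have hs2 := ((σ ^ K) i).isLt
  have h5 : ((σ ^ K) i).val - 1 ≡ i.val - 1 [MOD (n ^ K - 1)] := by
    apply Nat.ModEq.add_right_cancel' 1
    rwa [Nat.sub_add_cancel (by omega), Nat.sub_add_cancel (by omega)]
  have := h5.eq_of_lt_of_lt (by omega) (by omega)
  omega

/-- Let `n ≥ 1`, `K ≥ 1`, `N' = n^(K−1)`.  For `k = 0,…,n−1` let `w_n(k)`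
be the `n×1` column matrix with a single `1` in position `k`, and let
`Q = ∑_k w_n(k) ⊗ I_{N'} ⊗ w_n(k)ᵀ` (Kronecker products), viewed as an
`n^K × n^K` matrix via the canonical identifications of the index types with `Fin (n^K)`.
Then `Q` is a permutation (orthogonal) matrix, `Q·Qᵀ = I`, and `Q^K = I`:
`Q` is a valid symmetry operator of order `K` for the `K`-ary PPM constellation. -/
theorem ppm_symmetry_operator
    (n K : ℕ) (hn : 1 ≤ n) (hK : 1 ≤ K)
    (N' : ℕ) (hN' : N' = n ^ (K - 1))
    (w : Fin n → Matrix (Fin n) (Fin 1) ℝ)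
    (hw : ∀ k i j, w k i j = if i = k then 1 else 0)
    (Q₀ : Matrix ((Fin n × Fin N') × Fin 1) ((Fin 1 × Fin N') × Fin n) ℝ)
    (hQ₀ : Q₀ = ∑ k : Fin n, (w k ⊗ₖ (1 : Matrix (Fin N') (Fin N') ℝ)) ⊗ₖ (w k)ᵀ)
    (hrow : n * N' * 1 = n ^ K) (hcol : 1 * N' * n = n ^ K)
    (Q : Matrix (Fin (n ^ K)) (Fin (n ^ K)) ℝ)
    (hQ : Q = Matrix.reindex
      (((finProdFinEquiv.prodCongr (Equiv.refl (Fin 1))).trans finProdFinEquiv).trans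
        (finCongr hrow))
      (((finProdFinEquiv.prodCongr (Equiv.refl (Fin n))).trans finProdFinEquiv).trans
        (finCongr hcol)) Q₀) :
    (∃ σ : Equiv.Perm (Fin (n ^ K)), Q = σ.permMatrix ℝ) ∧
    Q * Qᵀ = 1 ∧ Q ^ K = 1 := by
  have hM : 1 ≤ n ^ K := Nat.one_le_pow _ _ hn
  have hN : N' * n = n ^ K := by simpa using hcol
  set er := ((finProdFinEquiv.prodCongr (Equiv.refl (Fin 1))).trans finProdFinEquiv).trans
        (finCongr hrow) with her
  set ec := ((finProdFinEquiv.prodCongr (Equiv.refl (Fin n))).trans finProdFinEquiv).trans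
        (finCongr hcol) with hec
  let e : (Fin n × Fin N') × Fin 1 ≃ (Fin 1 × Fin N') × Fin n :=
    { toFun := fun x => ((x.2, x.1.2), x.1.1)
      invFun := fun y => ((y.2, y.1.2), y.1.1)
      left_inv := fun _ => rfl
      right_inv := fun _ => rfl }
  let σ : Equiv.Perm (Fin (n ^ K)) := er.symm.trans (e.trans ec)
  have hσ : ∀ x, σ (er x) = ec (e x) := fun x => by simp [σ]
  have hervals : ∀ x, (er x).val = x.1.2.val + N' * x.1.1.val := by
    rintro ⟨⟨k, a⟩, z⟩
    simp [her, finProdFinEquiv]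
  have hecvals : ∀ x, (ec x).val = x.2.val + n * x.1.2.val := by
    rintro ⟨⟨z, a⟩, k⟩
    simp [hec, finProdFinEquiv]
  have hQσ : Q = σ.permMatrix ℝ := by
    ext i j
    obtain ⟨⟨⟨k, a⟩, z⟩, rfl⟩ := er.surjective i
    obtain ⟨⟨⟨z', b⟩, l⟩, rfl⟩ := ec.surjective j
    rw [hQ, hQ₀, Equiv.Perm.permMatrix, PEquiv.toMatrix_apply]
    simp only [Equiv.toPEquiv_apply, Option.mem_def, Option.some.injEq, hσ,
      ec.injective.eq_iff]
    simp [Matrix.sum_apply, hw, e, Matrix.one_apply, Subsingleton.elim z z']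
    grind
  have hK1 : σ ^ K = 1 := by
    apply ppm_order_aux hn
    · intro i hi
      obtain ⟨⟨⟨k, a⟩, z⟩, rfl⟩ := er.surjective i
      rw [hσ, hecvals]
      rw [hervals] at hi
      have hN0 : N' ≠ 0 := by have := a.isLt; omega
      simp [hN0] at hi
      simp [e, hi]
    · intro i
      obtain ⟨⟨⟨k, a⟩, z⟩, rfl⟩ := er.surjective i
      rw [hσ, hecvals, hervals]
      simp only [e, Equiv.coe_fn_mk]
      have h3 : n ^ K ≡ 1 [MOD (n ^ K - 1)] :=
        ((Nat.modEq_iff_dvd' hM).2 dvd_rfl).symm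
      have h4 := ((h3.mul_right k.val).add_left (n * a.val)).symm
      rw [one_mul] at h4
      have h5 : n * (a.val + N' * k.val) = n * a.val + n ^ K * k.val := by
        rw [← hN]; ring
      rw [h5, add_comm k.val]
      exact h4
  refine ⟨⟨σ, hQσ⟩, ?_, ?_⟩
  · rw [hQσ, Matrix.transpose_permMatrix, ← Matrix.permMatrix_mul]
    simp
  · rw [hQσ, ppm_pow_aux, hK1]
    simp
end

section
/- Williamson's theorem: let N ≥ 1 and let V be a 2N×2N real symmetric positive definite matrix. Then there exist a real symplectic matrix S_w (i.e., S_w·Ω·S_wᵀ = Ω, where Ω is the standard symplectic form on ℝ^{2N}) and positive real numbers σ²_1, …, σ²_N such that V = S_w·V^⊕·S_wᵀ with V^⊕ = diag(σ²_1, σ²_1, σ²_2, σ²_2, …, σ²_N, σ²_N); the σ²_i are called the symplectic eigenvalues of V. -/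
open Matrix

theorem skew_step {E : Type*} [NormedAddCommGroup E] [InnerProductSpace ℝ E] [FiniteDimensional ℝ E]
    (A : E →ₗ[ℝ] E) (hA : ∀ x y, inner ℝ (A x) y = - inner ℝ x (A y)) (hinj : ∀ x, A x = 0 → x = 0)
    (K : Submodule ℝ E) (hK : ∀ x ∈ K, A x ∈ K) (hne : K ≠ ⊥) :
    ∃ (u v : E) (l : ℝ), u ∈ K ∧ v ∈ K ∧ 0 < l ∧ inner ℝ u u = (1:ℝ) ∧ inner ℝ v v = (1:ℝ) ∧
      inner ℝ u v = (0:ℝ) ∧ A u = (-l) • v ∧ A v = l • u := by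
  have hK2 : ∀ x ∈ K, (A ∘ₗ A) x ∈ K := fun x hx => hK _ (hK _ hx)
  let T : K →ₗ[ℝ] K := (A ∘ₗ A).restrict hK2
  have hT : T.IsSymmetric := by
    intro x y
    change inner ℝ (A (A x)) (y : E) = inner ℝ (x : E) (A (A y))
    rw [hA, hA, neg_neg]
  have : Nontrivial K := Submodule.nontrivial_iff_ne_bot.mpr hne
  obtain ⟨x, hx⟩ := hT.hasEigenvalue_iSup_of_finiteDimensional.exists_hasEigenvector
  generalize (⨆ x : { x : K // x ≠ 0 }, RCLike.re (inner ℝ (T x) (x : K)) / ‖(x : K)‖ ^ 2 : ℝ) = μ at hx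
  have hx1 : A (A x) = μ • (x : E) := congrArg Subtype.val hx.apply_eq_smul
  have hx0 : (x : E) ≠ 0 := fun h => hx.2 (Subtype.ext h)
  have hxn : 0 < ‖(x : E)‖ := norm_pos_iff.mpr hx0
  obtain ⟨u, hu⟩ : ∃ u : E, u = ‖(x : E)‖⁻¹ • (x : E) := ⟨_, rfl⟩
  have huK : u ∈ K := hu ▸ K.smul_mem _ x.2
  have hun : ‖u‖ = 1 := by
    rw [hu, norm_smul, norm_inv, norm_norm, inv_mul_cancel₀ hxn.ne']
  have huu : inner ℝ u u = (1:ℝ) := by rw [real_inner_self_eq_norm_sq, hun]; norm_num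
  have hu1 : A (A u) = μ • u := by rw [hu]; simp only [map_smul, hx1]; rw [smul_comm]
  have hAu : A u ≠ 0 := fun h => by
    have := hinj _ h
    rw [this] at hun; simp at hun
  have hl : 0 < ‖A u‖ := norm_pos_iff.mpr hAu
  have hμ : μ = - ‖A u‖ ^ 2 := by
    have h := hA (A u) u
    rw [hu1, real_inner_smul_left, huu, real_inner_self_eq_norm_sq] at h
    linarith
  have h0 : inner ℝ u (A u) = (0:ℝ) := by
    have h := hA u u
    rw [real_inner_comm] at h
    linarith
  refine ⟨u, (-‖A u‖⁻¹) • A u, ‖A u‖, huK, K.smul_mem _ (hK _ huK), hl, huu, ?_, ?_, ?_, ?_⟩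
  · rw [real_inner_smul_left, real_inner_smul_right, real_inner_self_eq_norm_sq]
    field_simp
  · rw [real_inner_smul_right, h0, mul_zero]
  · rw [smul_smul, neg_mul_neg, mul_inv_cancel₀ hl.ne', one_smul]
  · rw [map_smul, hu1, smul_smul, hμ]
    congr 1
    field_simp

theorem skew_normal {E : Type*} [NormedAddCommGroup E] [InnerProductSpace ℝ E] [FiniteDimensional ℝ E]
    (A : E →ₗ[ℝ] E) (hA : ∀ x y, inner ℝ (A x) y = - inner ℝ x (A y)) (hinj : ∀ x, A x = 0 → x = 0)
    (k : ℕ) (hk : 2 * k ≤ Module.finrank ℝ E) :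
    ∃ (e : Fin k → Fin 2 → E) (l : Fin k → ℝ), (∀ i, 0 < l i) ∧
      (∀ i j a b, inner ℝ (e i a) (e j b) = if i = j ∧ a = b then (1:ℝ) else 0) ∧
      ∀ i, A (e i 0) = (- l i) • e i 1 ∧ A (e i 1) = l i • e i 0 := by
  induction k with
  | zero => exact ⟨fun i => i.elim0, fun i => i.elim0, fun i => i.elim0, fun i => i.elim0, fun i => i.elim0⟩
  | succ k ih =>
    obtain ⟨e, l, hl, ho, he⟩ := ih (by omega)
    let W : Submodule ℝ E := Submodule.span ℝ (Set.range fun p : Fin k × Fin 2 => e p.1 p.2)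
    have hmem : ∀ x, x ∈ Wᗮ ↔ ∀ i a, inner ℝ (e i a) x = (0:ℝ) := by
      intro x
      rw [Submodule.mem_orthogonal]
      constructor
      · intro h i a
        exact h _ (Submodule.subset_span ⟨(i, a), rfl⟩)
      · intro h u hu
        induction hu using Submodule.span_induction with
        | mem y hy => obtain ⟨p, rfl⟩ := hy; exact h _ _
        | zero => simp
        | add y z _ _ h1 h2 => rw [inner_add_left, h1, h2, add_zero]
        | smul c y _ h1 => rw [real_inner_smul_left, h1, mul_zero]
    have hinv : ∀ x ∈ Wᗮ, A x ∈ Wᗮ := by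
      intro x hx
      rw [hmem] at hx ⊢
      intro i a
      have h := hA (e i a) x
      have h2 : inner ℝ (A (e i a)) x = (0:ℝ) := by
        fin_cases a
        · change inner ℝ (A (e i 0)) x = (0:ℝ)
          rw [(he i).1, real_inner_smul_left, hx, mul_zero]
        · change inner ℝ (A (e i 1)) x = (0:ℝ)
          rw [(he i).2, real_inner_smul_left, hx, mul_zero]
      linarith
    have hne : Wᗮ ≠ ⊥ := by
      intro h
      have h1 := W.finrank_add_finrank_orthogonal
      have h2 : Module.finrank ℝ W ≤ _ := finrank_range_le_card (R := ℝ) (fun p : Fin k × Fin 2 => e p.1 p.2)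
      rw [h, finrank_bot] at h1
      simp at h2
      omega
    obtain ⟨u, v, m, hu, hv, hm, huu, hvv, huv, hAu, hAv⟩ := skew_step A hA hinj Wᗮ hinv hne
    rw [hmem] at hu hv
    have hvu : inner ℝ v u = (0:ℝ) := by rw [real_inner_comm]; exact huv
    have hun : ‖u‖ = 1 := by
      rw [real_inner_self_eq_norm_sq] at huu
      nlinarith [norm_nonneg u]
    have hvn : ‖v‖ = 1 := by
      rw [real_inner_self_eq_norm_sq] at hvv
      nlinarith [norm_nonneg v]
    have hu' : ∀ i a, inner ℝ u (e i a) = (0:ℝ) := fun i a => by rw [real_inner_comm]; exact hu i a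
    have hv' : ∀ i a, inner ℝ v (e i a) = (0:ℝ) := fun i a => by rw [real_inner_comm]; exact hv i a
    refine ⟨Fin.snoc (α := fun _ => Fin 2 → E) e ![u, v], Fin.snoc (α := fun _ => ℝ) l m, ?_, ?_, ?_⟩
    · intro i
      induction i using Fin.lastCases with
      | last => simpa using hm
      | cast i => simpa using hl i
    · intro i j
      induction i using Fin.lastCases with
      | last =>
        induction j using Fin.lastCases with
        | last =>
          intro a b
          fin_cases a <;> fin_cases b <;> simp [hvu, huv, hun, hvn]
        | cast j =>
          intro a b
          fin_cases a <;> simp [hu', hv', (Fin.castSucc_lt_last j).ne']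
      | cast i =>
        induction j using Fin.lastCases with
        | last =>
          intro a b
          fin_cases b <;> simp [hu, hv, (Fin.castSucc_lt_last i).ne]
        | cast j =>
          intro a b
          simp [ho]
    · intro i
      induction i using Fin.lastCases with
      | last => simp [hAu, hAv]
      | cast i => simpa using he i

/-- **Williamson's theorem.** Let `N ≥ 1` and let `V` be a `2N×2N` real
symmetric positive definite matrix.  Then there exist a real symplectic matrix `S_w`
(`S_w·Ω·S_wᵀ = Ω`, with `Ω` the standard symplectic form, block diagonal with `2×2`
blocks `[[0,1],[−1,0]]`) and positive reals `σ²_1, …, σ²_N` such that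
`V = S_w·V^⊕·S_wᵀ` with `V^⊕ = diag(σ²_1, σ²_1, …, σ²_N, σ²_N)`.
Here the index `2N` is realized as `Fin N × Fin 2`, pairing each mode `i` with its two
quadratures, so `Ω (i,a) (j,b)` is `1` if `i = j, a = 0, b = 1`, `−1` if
`i = j, a = 1, b = 0`, and `0` otherwise, and `V^⊕ = diagonal (fun (i,_) => σ² i)`. -/
theorem williamson_theorem
    (N : ℕ) (hN : 1 ≤ N)
    (Ω : Matrix (Fin N × Fin 2) (Fin N × Fin 2) ℝ)
    (hΩ : ∀ i j : Fin N × Fin 2, Ω i j =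
      if i.1 = j.1 then
        (if i.2 = 0 ∧ j.2 = 1 then 1 else if i.2 = 1 ∧ j.2 = 0 then -1 else 0)
      else 0)
    (V : Matrix (Fin N × Fin 2) (Fin N × Fin 2) ℝ)
    (hVsymm : V.IsSymm) (hVpos : V.PosDef) :
    ∃ (Sw : Matrix (Fin N × Fin 2) (Fin N × Fin 2) ℝ) (σsq : Fin N → ℝ),
      Sw * Ω * Swᵀ = Ω ∧
      (∀ i, 0 < σsq i) ∧
      V = Sw * Matrix.diagonal (fun p : Fin N × Fin 2 => σsq p.1) * Swᵀ := by
  have hΩT : Ωᵀ = -Ω := by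
    ext ⟨i, a⟩ ⟨j, b⟩
    rw [transpose_apply, neg_apply, hΩ, hΩ]
    fin_cases a <;> fin_cases b <;> by_cases h : i = j <;> simp [h, eq_comm]
  have hΩ2 : Ω * Ω = -1 := by
    ext ⟨i, a⟩ ⟨j, b⟩
    rw [mul_apply, Fintype.sum_prod_type]
    simp only [hΩ, Fin.sum_univ_two]
    fin_cases a <;> fin_cases b <;> by_cases h : i = j <;> simp [h, Matrix.one_apply]
  obtain ⟨Y, hY⟩ : ∃ Y : Matrix (Fin N × Fin 2) (Fin N × Fin 2) ℝ, V = Yᵀ * Y := by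
    open scoped MatrixOrder Matrix.Norms.L2Operator in
    obtain ⟨y, hy⟩ := CStarAlgebra.nonneg_iff_eq_star_mul_self.mp hVpos.posSemidef.nonneg
    exact ⟨y, by rw [hy, star_eq_conjTranspose, conjTranspose_eq_transpose_of_trivial]⟩
  have hYu : IsUnit Y.det := by
    have h := hVpos.det_pos
    rw [hY, det_mul, det_transpose] at h
    exact isUnit_iff_ne_zero.mpr fun h0 => by simp [h0] at h
  obtain ⟨Z, hZ⟩ : ∃ Z, Z = Y⁻¹ := ⟨_, rfl⟩
  have hYZ : Y * Z = 1 := by rw [hZ, mul_nonsing_inv _ hYu]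
  have hZY : Z * Y = 1 := by rw [hZ, nonsing_inv_mul _ hYu]
  have hZYT : Yᵀ * Zᵀ = 1 := by rw [← transpose_mul, hZY, transpose_one]
  have hYZT : Zᵀ * Yᵀ = 1 := by rw [← transpose_mul, hYZ, transpose_one]
  obtain ⟨M, hM⟩ : ∃ M, M = Zᵀ * Ω * Z := ⟨_, rfl⟩
  have hMT : Mᵀ = -M := by
    rw [hM]
    simp only [transpose_mul, transpose_transpose, hΩT, Matrix.neg_mul, Matrix.mul_neg, Matrix.mul_assoc]
  have hMinv : -(Y * Ω * Yᵀ) * M = 1 := by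
    calc -(Y * Ω * Yᵀ) * M = -(Y * Ω * (Yᵀ * Zᵀ) * Ω * Z) := by
          rw [hM]; simp only [Matrix.neg_mul, Matrix.mul_assoc]
      _ = -(Y * (Ω * Ω) * Z) := by rw [hZYT, Matrix.mul_one]; simp only [Matrix.mul_assoc]
      _ = 1 := by rw [hΩ2]; simp [hYZ]
  have hYMY : Yᵀ * M * Y = Ω := by
    calc Yᵀ * M * Y = (Yᵀ * Zᵀ) * Ω * (Z * Y) := by rw [hM]; simp only [Matrix.mul_assoc]
      _ = Ω := by rw [hZYT, hZY, Matrix.one_mul, Matrix.mul_one]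
  have hin : ∀ x y : EuclideanSpace ℝ (Fin N × Fin 2), inner ℝ x y = x.ofLp ⬝ᵥ y.ofLp := by
    intro x y
    rw [EuclideanSpace.inner_eq_star_dotProduct, star_trivial, dotProduct_comm]
  obtain ⟨e, l, hl, ho, he⟩ := skew_normal (Matrix.toEuclideanLin M)
    (by
      intro x y
      rw [hin, hin, ofLp_toEuclideanLin_apply, ofLp_toEuclideanLin_apply, dotProduct_mulVec,
        ← mulVec_transpose, hMT, neg_mulVec, neg_dotProduct, neg_neg])
    (by
      intro x hx
      have h1 : M *ᵥ x.ofLp = 0 := by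
        rw [← ofLp_toEuclideanLin_apply, hx]; rfl
      have h2 : (-(Y * Ω * Yᵀ)) *ᵥ (M *ᵥ x.ofLp) = x.ofLp := by
        rw [mulVec_mulVec, hMinv, one_mulVec]
      rw [h1, mulVec_zero] at h2
      ext i
      rw [← h2]; rfl)
    N (by simp [mul_comm])
  obtain ⟨O, hO⟩ : ∃ O : Matrix (Fin N × Fin 2) (Fin N × Fin 2) ℝ,
    O = Matrix.of fun p q => (e q.1 q.2).ofLp p := ⟨_, rfl⟩
  have hOO : Oᵀ * O = 1 := by
    ext ⟨i, a⟩ ⟨j, b⟩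
    have h := ho i j a b
    rw [hin] at h
    rw [Matrix.one_apply, Matrix.mul_apply]
    simp only [Prod.mk.injEq]
    rw [← h, hO]
    rfl
  have hOO' : O * Oᵀ = 1 := mul_eq_one_comm.mp hOO
  obtain ⟨Δ, hΔ⟩ : ∃ Δ : Matrix (Fin N × Fin 2) (Fin N × Fin 2) ℝ,
    Δ = Matrix.diagonal fun p => Real.sqrt (l p.1) := ⟨_, rfl⟩
  have hΔT : Δᵀ = Δ := by rw [hΔ, diagonal_transpose]
  have hMO : M * O = O * (Δ * Ω * Δ) := by
    ext p ⟨j, b⟩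
    have hs : Real.sqrt (l j) * Real.sqrt (l j) = l j := Real.mul_self_sqrt (hl j).le
    have h0 : (M *ᵥ (e j 0).ofLp) p = - l j * (e j 1).ofLp p := by
      rw [← ofLp_toEuclideanLin_apply, (he j).1]; rfl
    have h1 : (M *ᵥ (e j 1).ofLp) p = l j * (e j 0).ofLp p := by
      rw [← ofLp_toEuclideanLin_apply, (he j).2]; rfl
    have hL : (M * O) p (j, b) = (M *ᵥ (e j b).ofLp) p := by rw [hO]; rfl
    rw [hL, mul_apply, Fintype.sum_prod_type, hΔ]
    simp only [mul_diagonal, diagonal_mul, hΩ, Fin.sum_univ_two, hO, of_apply]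
    rw [Finset.sum_eq_single j]
    · fin_cases b
      · simp [h0]
        linear_combination -(e j 1).ofLp p * hs
      · simp [h1]
        linear_combination -(e j 0).ofLp p * hs
    · intro i _ hij
      simp [hij]
    · simp
  have hΔD : Δ * Matrix.diagonal (fun p : Fin N × Fin 2 => (l p.1)⁻¹) * Δ = 1 := by
    rw [hΔ, diagonal_mul_diagonal, diagonal_mul_diagonal, ← diagonal_one]
    congr 1
    ext p
    have hs : Real.sqrt (l p.1) * Real.sqrt (l p.1) = l p.1 := Real.mul_self_sqrt (hl p.1).le
    rw [mul_right_comm, hs, mul_inv_cancel₀ (hl p.1).ne']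
  refine ⟨Yᵀ * O * Δ, fun i => (l i)⁻¹, ?_, fun i => inv_pos.mpr (hl i), ?_⟩
  · calc Yᵀ * O * Δ * Ω * (Yᵀ * O * Δ)ᵀ = Yᵀ * (O * (Δ * Ω * Δ)) * Oᵀ * Y := by
          simp only [transpose_mul, transpose_transpose, hΔT, Matrix.mul_assoc]
      _ = Yᵀ * M * (O * Oᵀ) * Y := by rw [← hMO]; simp only [Matrix.mul_assoc]
      _ = Ω := by rw [hOO', Matrix.mul_one, hYMY]
  · symm
    calc Yᵀ * O * Δ * Matrix.diagonal (fun p : Fin N × Fin 2 => (l p.1)⁻¹) * (Yᵀ * O * Δ)ᵀ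
        = Yᵀ * O * (Δ * Matrix.diagonal (fun p : Fin N × Fin 2 => (l p.1)⁻¹) * Δ) * Oᵀ * Y := by
          simp only [transpose_mul, transpose_transpose, hΔT, Matrix.mul_assoc]
      _ = Yᵀ * (O * Oᵀ) * Y := by rw [hΔD, Matrix.mul_one]; simp only [Matrix.mul_assoc]
      _ = V := by rw [hOO', Matrix.mul_one, hY]
end
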